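/- Let G be a weak near-triangulation and let D ⊆ V(G) be a set of vertices such that D ⊆ N[y] for some y ∈ D. If D contains at least one external vertex of G, then every bounded face of G−D is triangular. -/

import Mathlib

open Set

/-- A plane graph: a finite simple graph whose vertices are points of the plane,
together with a plane embedding in which every edge is drawn as an arc (the range of an
injective path) joining its endpoints, two arcs meet only in common endpoints, and
no vertex lies on an arc other than at its endpoints. -/
structure PlaneGraph where
  verts : Set (ℝ × ℝ)
  finite_verts : verts.Finite
  Adj : (ℝ × ℝ) → (ℝ × ℝ) → Prop
  adj_symm : ∀ u v, Adj u v → Adj v u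
  adj_irrefl : ∀ v, ¬ Adj v v
  adj_mem : ∀ u v, Adj u v → u ∈ verts
  arc : (ℝ × ℝ) → (ℝ × ℝ) → Set (ℝ × ℝ)
  arc_symm : ∀ u v, arc u v = arc v u
  arc_path : ∀ u v, Adj u v → ∃ γ : Path u v, Function.Injective ⇑γ ∧ arc u v = Set.range ⇑γ
  arc_verts : ∀ u v, Adj u v → verts ∩ arc u v ⊆ {u, v}
  arc_inter : ∀ u v u' v', Adj u v → Adj u' v' → ({u, v} : Set (ℝ × ℝ)) ≠ {u', v'} →
    arc u v ∩ arc u' v' ⊆ ({u, v} : Set (ℝ × ℝ)) ∩ {u', v'}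

namespace PlaneGraph

/-- The plane subgraph induced on a set of vertices, with the inherited embedding. -/
def induce (G : PlaneGraph) (S : Set (ℝ × ℝ)) : PlaneGraph where
  verts := G.verts ∩ S
  finite_verts := G.finite_verts.subset inter_subset_left
  Adj u v := G.Adj u v ∧ u ∈ S ∧ v ∈ S
  adj_symm _ _ h := ⟨G.adj_symm _ _ h.1, h.2.2, h.2.1⟩
  adj_irrefl v h := G.adj_irrefl v h.1
  adj_mem _ _ h := ⟨G.adj_mem _ _ h.1, h.2.1⟩
  arc := G.arc
  arc_symm := G.arc_symm
  arc_path _ _ h := G.arc_path _ _ h.1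
  arc_verts _ _ h := fun _ hx => G.arc_verts _ _ h.1 ⟨hx.1.1, hx.2⟩
  arc_inter _ _ _ _ h h' hne := G.arc_inter _ _ _ _ h.1 h'.1 hne

/-- Deleting a set of vertices (together with all incident edges),
keeping the inherited embedding. -/
def delete (G : PlaneGraph) (X : Set (ℝ × ℝ)) : PlaneGraph := G.induce Xᶜ

/-- Deleting a single vertex. -/
def erase (G : PlaneGraph) (x : ℝ × ℝ) : PlaneGraph := G.delete {x}

/-- The point set of the plane drawing of `G`. -/
def drawing (G : PlaneGraph) : Set (ℝ × ℝ) :=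
  G.verts ∪ ⋃ (u) (v) (_ : G.Adj u v), G.arc u v

/-- The faces of `G`: connected components of the complement of the drawing. -/
def IsFace (G : PlaneGraph) (F : Set (ℝ × ℝ)) : Prop :=
  ∃ x, x ∉ G.drawing ∧ F = connectedComponentIn G.drawingᶜ x

/-- A vertex is external if it is incident to (i.e. lies on the boundary of)
an unbounded face. -/
def ExternalVertex (G : PlaneGraph) (v : ℝ × ℝ) : Prop :=
  v ∈ G.verts ∧ ∃ F, G.IsFace F ∧ ¬ Bornology.IsBounded F ∧ v ∈ closure F

/-- A triangle (cycle on three vertices) of `G`. -/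
def IsTriangle (G : PlaneGraph) (a b c : ℝ × ℝ) : Prop :=
  a ≠ b ∧ a ≠ c ∧ b ≠ c ∧ G.Adj a b ∧ G.Adj b c ∧ G.Adj a c

/-- `v` is contained in a triangle of `G`. -/
def InTriangle (G : PlaneGraph) (v : ℝ × ℝ) : Prop := ∃ b c, G.IsTriangle v b c

/-- The drawing of the closed curve formed by a triangle on `a`, `b`, `c`. -/
def triDrawing (G : PlaneGraph) (a b c : ℝ × ℝ) : Set (ℝ × ℝ) :=
  G.arc a b ∪ G.arc b c ∪ G.arc a c

/-- A face is triangular if its boundary is the drawing of a triangle of `G`. -/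
def IsTriangularFace (G : PlaneGraph) (F : Set (ℝ × ℝ)) : Prop :=
  ∃ a b c, G.IsTriangle a b c ∧ frontier F = G.triDrawing a b c

/-- The interior region of the closed curve drawn by a triangle: the union of the
bounded connected components of the complement of its drawing. -/
def triangleInterior (G : PlaneGraph) (a b c : ℝ × ℝ) : Set (ℝ × ℝ) :=
  {x | x ∉ G.triDrawing a b c ∧
    Bornology.IsBounded (connectedComponentIn (G.triDrawing a b c)ᶜ x)}

/-- A facial triangle: a triangle whose interior region is a face of `G`. -/
def IsFacialTriangle (G : PlaneGraph) (a b c : ℝ × ℝ) : Prop :=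
  G.IsTriangle a b c ∧ G.IsFace (G.triangleInterior a b c)

/-- A weak near-triangulation: every bounded face is triangular and every vertex
is contained in a triangle. -/
def IsWNT (G : PlaneGraph) : Prop :=
  (∀ F, G.IsFace F → Bornology.IsBounded F → G.IsTriangularFace F) ∧
  ∀ v ∈ G.verts, G.InTriangle v

/-- Reachability by walks in `G`. -/
def Reachable (G : PlaneGraph) (u v : ℝ × ℝ) : Prop := Relation.ReflTransGen G.Adj u v

/-- Connectedness of `G`. -/
def Connected (G : PlaneGraph) : Prop :=
  G.verts.Nonempty ∧ ∀ u ∈ G.verts, ∀ v ∈ G.verts, G.Reachable u v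

/-- A cutvertex: a vertex whose deletion separates two other vertices. -/
def IsCutvertex (G : PlaneGraph) (v : ℝ × ℝ) : Prop :=
  v ∈ G.verts ∧ ∃ a b, a ∈ G.verts ∧ b ∈ G.verts ∧ a ≠ v ∧ b ≠ v ∧
    G.Reachable a b ∧ ¬ (G.erase v).Reachable a b

/-- 2-connectivity: connected, on at least three vertices, with no cutvertex. -/
def TwoConnected (G : PlaneGraph) : Prop :=
  G.Connected ∧ 3 ≤ G.verts.ncard ∧ ∀ v, ¬ G.IsCutvertex v

/-- A near-triangulation: a 2-connected plane graph all of whose bounded faces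
are triangular. -/
def IsNearTriangulation (G : PlaneGraph) : Prop :=
  G.TwoConnected ∧ ∀ F, G.IsFace F → Bornology.IsBounded F → G.IsTriangularFace F

/-- A plane triangulation: a connected plane graph all of whose faces (including
the unbounded one) are triangular. -/
def IsTriangulation (G : PlaneGraph) : Prop :=
  G.Connected ∧ ∀ F, G.IsFace F → G.IsTriangularFace F

/-- A block of `G`, given by its vertex set `B`: a maximal set of vertices inducing
a connected subgraph without a cutvertex. -/
def IsBlock (G : PlaneGraph) (B : Set (ℝ × ℝ)) : Prop :=
  B ⊆ G.verts ∧ (G.induce B).Connected ∧ (∀ v, ¬ (G.induce B).IsCutvertex v) ∧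
  ∀ B', B ⊆ B' → B' ⊆ G.verts → (G.induce B').Connected →
    (∀ v, ¬ (G.induce B').IsCutvertex v) → B' = B

/-- A plane graph is outerplanar if all of its vertices are incident to the
unbounded face. -/
def IsOuterplanar (G : PlaneGraph) : Prop := ∀ v ∈ G.verts, G.ExternalVertex v

/-- A dominating set of `G`. -/
def IsDominatingSet (G : PlaneGraph) (D : Set (ℝ × ℝ)) : Prop :=
  D ⊆ G.verts ∧ ∀ v ∈ G.verts, v ∉ D → ∃ d ∈ D, G.Adj v d

/-- The domination number of `G`. -/
noncomputable def dominationNumber (G : PlaneGraph) : ℕ :=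
  sInf {n | ∃ D, G.IsDominatingSet D ∧ D.ncard = n}

/-- `u` is problematic in `G` if `G − u` is not a weak near-triangulation. -/
def Problematic (G : PlaneGraph) (u : ℝ × ℝ) : Prop := ¬ (G.erase u).IsWNT

/-- `x` is a `u`-bad vertex in `G`: a vertex of `G − u` not contained in a triangle
of `G − u`. -/
def IsBadFor (G : PlaneGraph) (u x : ℝ × ℝ) : Prop :=
  x ∈ G.verts ∧ x ≠ u ∧ ¬ (G.erase u).InTriangle x

end PlaneGraph

namespace PlaneGraph

theorem isClosed_drawing (G : PlaneGraph) : IsClosed G.drawing := by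
  have hE : {p : (ℝ × ℝ) × (ℝ × ℝ) | G.Adj p.1 p.2}.Finite :=
    (G.finite_verts.prod G.finite_verts).subset fun p hp =>
      ⟨G.adj_mem _ _ hp, G.adj_mem _ _ (G.adj_symm _ _ hp)⟩
  have h : G.drawing =
      G.verts ∪ ⋃ p ∈ {p : (ℝ × ℝ) × (ℝ × ℝ) | G.Adj p.1 p.2}, G.arc p.1 p.2 := by
    ext z
    simp [drawing]
  rw [h]
  refine G.finite_verts.isClosed.union (hE.isClosed_biUnion fun p hp => ?_)
  obtain ⟨γ, -, hγ⟩ := G.arc_path _ _ hp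
  rw [hγ]
  exact (isCompact_range γ.continuous).isClosed

theorem arc_subset_drawing (G : PlaneGraph) {u v : ℝ × ℝ} (h : G.Adj u v) :
    G.arc u v ⊆ G.drawing := fun _ hz =>
  Or.inr (mem_iUnion₂.2 ⟨u, v, mem_iUnion.2 ⟨h, hz⟩⟩)

theorem mem_arc_left (G : PlaneGraph) {u v : ℝ × ℝ} (h : G.Adj u v) : u ∈ G.arc u v := by
  obtain ⟨γ, -, hγ⟩ := G.arc_path _ _ h
  rw [hγ]
  exact ⟨0, γ.source⟩

theorem mem_arc_right (G : PlaneGraph) {u v : ℝ × ℝ} (h : G.Adj u v) : v ∈ G.arc u v := by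
  rw [G.arc_symm]
  exact G.mem_arc_left (G.adj_symm _ _ h)

theorem delete_drawing_subset (G : PlaneGraph) (D : Set (ℝ × ℝ)) :
    (G.delete D).drawing ⊆ G.drawing := by
  rintro z (hz | hz)
  · exact Or.inl hz.1
  · simp only [mem_iUnion] at hz
    obtain ⟨u, v, h, hz⟩ := hz
    exact G.arc_subset_drawing h.1 hz

theorem notMem_delete_drawing (G : PlaneGraph) {D : Set (ℝ × ℝ)} {d : ℝ × ℝ}
    (hd : d ∈ D) (hdG : d ∈ G.verts) : d ∉ (G.delete D).drawing := by
  rintro (hz | hz)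
  · exact hz.2 hd
  · simp only [mem_iUnion] at hz
    obtain ⟨u, v, h, hz⟩ := hz
    rcases G.arc_verts _ _ h.1 ⟨hdG, hz⟩ with rfl | rfl
    · exact h.2.1 hd
    · exact h.2.2 hd

/-- An edge at a deleted vertex `u` meets the drawing of `G - D` at most in its other end. -/
theorem eq_of_mem_arc_of_mem_delete_drawing (G : PlaneGraph) {D : Set (ℝ × ℝ)}
    {u v z : ℝ × ℝ} (hu : u ∈ D) (h : G.Adj u v) (hz : z ∈ G.arc u v)
    (hz' : z ∈ (G.delete D).drawing) : z = v := by
  have hzu : z ≠ u := by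
    rintro rfl
    exact G.notMem_delete_drawing hu (G.adj_mem _ _ h) hz'
  have huv : z ∈ ({u, v} : Set (ℝ × ℝ)) := by
    rcases hz' with hz' | hz'
    · exact G.arc_verts _ _ h ⟨hz'.1, hz⟩
    · simp only [mem_iUnion] at hz'
      obtain ⟨u', v', h', hz'⟩ := hz'
      refine (G.arc_inter _ _ _ _ h h'.1 (fun he => ?_) ⟨hz, hz'⟩).1
      have hmem : u ∈ ({u', v'} : Set (ℝ × ℝ)) := he ▸ mem_insert u {v}
      rcases hmem with rfl | rfl
      · exact h'.2.1 hu
      · exact h'.2.2 hu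
  exact huv.resolve_left hzu

/-- A point of an edge at a deleted vertex `u` lies in the same face of `G - D` as `u`. -/
theorem mem_connectedComponentIn_of_mem_arc (G : PlaneGraph) {D : Set (ℝ × ℝ)}
    {u v x : ℝ × ℝ} (hu : u ∈ D) (h : G.Adj u v) (hx : x ∈ G.arc u v)
    (hx' : x ∉ (G.delete D).drawing) :
    u ∈ connectedComponentIn (G.delete D).drawingᶜ x := by
  obtain ⟨γ, hinj, hγ⟩ := G.arc_path _ _ h
  obtain ⟨t, rfl⟩ := hγ ▸ hx
  have hconn : IsPreconnected (γ '' Iic t) :=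
    isPreconnected_Iic.image _ γ.continuous.continuousOn
  refine hconn.subset_connectedComponentIn ⟨t, self_mem_Iic, rfl⟩ ?_
    ⟨0, unitInterval.nonneg', γ.source⟩
  rintro _ ⟨s, hs, rfl⟩ hmem
  have hsv := G.eq_of_mem_arc_of_mem_delete_drawing hu h (hγ ▸ mem_range_self s) hmem
  have hs1 : s = 1 := hinj (hsv.trans γ.target.symm)
  have hts : t = s := le_antisymm (hs1 ▸ unitInterval.le_one') hs
  exact hx' (hts ▸ hmem)

theorem mem_connectedComponentIn_of_mem_drawing (G : PlaneGraph) {D : Set (ℝ × ℝ)}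
    (hD : D ⊆ G.verts) {y x : ℝ × ℝ} (hy : y ∈ D) (hN : ∀ d ∈ D, d = y ∨ G.Adj y d)
    (hx : x ∈ G.drawing) (hx' : x ∉ (G.delete D).drawing) :
    y ∈ connectedComponentIn (G.delete D).drawingᶜ x := by
  have hd : ∀ d ∈ D, y ∈ connectedComponentIn (G.delete D).drawingᶜ d := fun d hd => by
    have hd' := G.notMem_delete_drawing hd (hD hd)
    rcases hN d hd with rfl | h
    · exact mem_connectedComponentIn hd'
    · exact G.mem_connectedComponentIn_of_mem_arc hy h (G.mem_arc_right h) hd'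
  have hstar : ∀ u v, u ∈ D → G.Adj u v → x ∈ G.arc u v →
      y ∈ connectedComponentIn (G.delete D).drawingᶜ x := fun u v hu h hxuv => by
    rw [connectedComponentIn_eq (G.mem_connectedComponentIn_of_mem_arc hu h hxuv hx')]
    exact hd u hu
  rcases hx with hx | hx
  · by_cases hxD : x ∈ D
    · exact hd x hxD
    · exact absurd (Or.inl ⟨hx, hxD⟩) hx'
  · simp only [mem_iUnion] at hx
    obtain ⟨u, v, h, hxuv⟩ := hx
    by_cases hu : u ∈ D
    · exact hstar u v hu h hxuv
    by_cases hv : v ∈ D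
    · exact hstar v u hv (G.adj_symm _ _ h) (G.arc_symm u v ▸ hxuv)
    · exact absurd ((G.delete D).arc_subset_drawing (u := u) (v := v) ⟨h, hu, hv⟩ hxuv) hx'

theorem frontier_connectedComponentIn_subset (G : PlaneGraph) (x : ℝ × ℝ) :
    frontier (connectedComponentIn G.drawingᶜ x) ⊆ G.drawing := by
  intro z hz
  by_contra hzK
  have hopen : ∀ w, IsOpen (connectedComponentIn G.drawingᶜ w) := fun _ =>
    G.isClosed_drawing.isOpen_compl.connectedComponentIn
  rw [(hopen x).frontier_eq] at hz
  obtain ⟨w, hwz, hwx⟩ := mem_closure_iff.1 hz.1 _ (hopen z) (mem_connectedComponentIn hzK)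
  apply hz.2
  rw [connectedComponentIn_eq hwx, ← connectedComponentIn_eq hwz]
  exact mem_connectedComponentIn hzK

end PlaneGraph

open PlaneGraph in
/-- Let `G` be a weak near-triangulation and `D ⊆ V(G)` with `D ⊆ N[y]` for some
`y ∈ D`. If `D` contains an external vertex of `G`, then every bounded face of
`G − D` is triangular. -/
theorem WNT_delete_dominated_set (G : PlaneGraph) (hG : G.IsWNT)
    (D : Set (ℝ × ℝ)) (hD : D ⊆ G.verts)
    (hN : ∃ y ∈ D, ∀ d ∈ D, d = y ∨ G.Adj y d)
    (hext : ∃ v ∈ D, G.ExternalVertex v) :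
    ∀ F, (G.delete D).IsFace F → Bornology.IsBounded F →
      (G.delete D).IsTriangularFace F := by
  rintro _ ⟨x, hx, rfl⟩ hbdd
  obtain ⟨y, hy, hN⟩ := hN
  obtain ⟨v, hv, hvG, F, ⟨p, hp, rfl⟩, hunb, hvF⟩ := hext
  have hmono : G.drawingᶜ ⊆ (G.delete D).drawingᶜ :=
    compl_subset_compl.2 (G.delete_drawing_subset D)
  by_cases hmeet : ∃ z ∈ connectedComponentIn (G.delete D).drawingᶜ x, z ∈ G.drawing
  · obtain ⟨z, hzx, hz⟩ := hmeet
    exfalso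
    have hopen : IsOpen (connectedComponentIn (G.delete D).drawingᶜ x) :=
      (G.delete D).isClosed_drawing.isOpen_compl.connectedComponentIn
    have hv' := G.notMem_delete_drawing hv hvG
    have hvx : v ∈ connectedComponentIn (G.delete D).drawingᶜ x := by
      rw [connectedComponentIn_eq hzx, connectedComponentIn_eq
        (G.mem_connectedComponentIn_of_mem_drawing hD hy hN hz
          (connectedComponentIn_subset _ _ hzx)),
        ← connectedComponentIn_eq
        (G.mem_connectedComponentIn_of_mem_drawing hD hy hN (Or.inl hvG) hv')]
      exact mem_connectedComponentIn hv'
    obtain ⟨w, hwx, hwp⟩ := mem_closure_iff.1 hvF _ hopen hvx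
    refine hunb (hbdd.subset ?_)
    rw [connectedComponentIn_eq hwx]
    exact isPreconnected_connectedComponentIn.subset_connectedComponentIn hwp
      ((connectedComponentIn_subset _ _).trans hmono)
  · push Not at hmeet
    have hxG : x ∉ G.drawing := hmeet x (mem_connectedComponentIn hx)
    have heq : connectedComponentIn (G.delete D).drawingᶜ x =
        connectedComponentIn G.drawingᶜ x :=
      (isPreconnected_connectedComponentIn.subset_connectedComponentIn
        (mem_connectedComponentIn hx) hmeet).antisymm (connectedComponentIn_mono x hmono)
    obtain ⟨a, b, c, ⟨hab, hac, hbc, h₁, h₂, h₃⟩, hfr⟩ := hG.1 _ ⟨x, hxG, heq⟩ hbdd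
    have hsub : G.triDrawing a b c ⊆ (G.delete D).drawing :=
      hfr ▸ (G.delete D).frontier_connectedComponentIn_subset x
    have hnot : ∀ d ∈ G.verts, d ∈ G.triDrawing a b c → d ∈ Dᶜ := fun d hdG hd hdD =>
      G.notMem_delete_drawing hdD hdG (hsub hd)
    have ha := hnot a (G.adj_mem _ _ h₁) (Or.inl (Or.inl (G.mem_arc_left h₁)))
    have hb := hnot b (G.adj_mem _ _ h₂) (Or.inl (Or.inl (G.mem_arc_right h₁)))
    have hc := hnot c (G.adj_mem _ _ (G.adj_symm _ _ h₂))
      (Or.inl (Or.inr (G.mem_arc_right h₂)))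
    exact ⟨a, b, c, ⟨hab, hac, hbc, ⟨h₁, ha, hb⟩, ⟨h₂, hb, hc⟩, ⟨h₃, ha, hc⟩⟩, hfr⟩
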